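/- arXiv:1206.4839 — 2 statements merged into one kernel-verified Lean document; each statement's English description precedes it below -/
import Mathlib

section
/- Let X and E be finite-dimensional real normed spaces and f : S_X → S_E a bijective isometry. Then f maps smooth points of S_X to smooth points of S_E: if y ∈ Σ(X), then f(y) ∈ Σ(E). -/
open Filter Topology Metric Set MeasureTheory

noncomputable section

/-- The normalized direction `v / ‖v‖` of a vector (equal to `0` when `v = 0`). -/
def unitDir {X : Type*} [NormedAddCommGroup X] [NormedSpace ℝ X] (v : X) : X := ‖v‖⁻¹ • v

/-- The set `ℷ(x)` of support functionals at a point `x` of the unit sphere: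
functionals of norm one attaining the value `1` at `x`. -/
def suppFn (X : Type*) [NormedAddCommGroup X] [NormedSpace ℝ X] (x : X) :
    Set (X →L[ℝ] ℝ) := {g | ‖g‖ = 1 ∧ g x = 1}

/-- A point of the unit sphere is smooth if it has exactly one support functional. -/
def IsSmoothPt {X : Type*} [NormedAddCommGroup X] [NormedSpace ℝ X] (x : X) : Prop :=
  ∃ g : X →L[ℝ] ℝ, suppFn X x = {g}

/-- `D_y = {x ∈ S_X : ‖x + y‖ < 2}`. -/
def Dset {X : Type*} [NormedAddCommGroup X] [NormedSpace ℝ X] (y : X) : Set X :=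
  {x | x ∈ sphere (0 : X) 1 ∧ ‖x + y‖ < 2}

/-- `W_y`: points `x ∈ D_y` with `(x-y)/‖x-y‖` smooth in `X` and
`(f x - f y)/‖f x - f y‖` smooth in `E`. -/
def Wset {X E : Type*} [NormedAddCommGroup X] [NormedSpace ℝ X]
    [NormedAddCommGroup E] [NormedSpace ℝ E] (f : X → E) (y : X) : Set X :=
  {x | x ∈ Dset y ∧ IsSmoothPt (unitDir (x - y)) ∧ IsSmoothPt (unitDir (f x - f y))}

/-- `Λ_y`: the set of limit points of `(y - z)/‖y - z‖` as `z → y`, `z ∈ S_X`, `z ≠ y`. -/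
def tangentDirs {X : Type*} [NormedAddCommGroup X] [NormedSpace ℝ X] (y : X) : Set X :=
  {u | ∃ z : ℕ → X, (∀ n, z n ∈ sphere (0 : X) 1 ∧ z n ≠ y) ∧
    Tendsto z atTop (𝓝 y) ∧ Tendsto (fun n => unitDir (y - z n)) atTop (𝓝 u)}

/-- A linear map `T` represents the tangent action of `f` at `y`: whenever `y_n → y` on the
sphere with `(y - y_n)/‖y - y_n‖ → u`, one has `(f y - f y_n)/‖f y - f y_n‖ → T u`. -/
def RepTangent {X E : Type*} [NormedAddCommGroup X] [NormedSpace ℝ X]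
    [NormedAddCommGroup E] [NormedSpace ℝ E] (f : X → E) (y : X) (T : X →ₗ[ℝ] E) : Prop :=
  ∀ (z : ℕ → X) (u : X), (∀ n, z n ∈ sphere (0 : X) 1 ∧ z n ≠ y) →
    Tendsto z atTop (𝓝 y) → Tendsto (fun n => unitDir (y - z n)) atTop (𝓝 u) →
    Tendsto (fun n => unitDir (f y - f (z n))) atTop (𝓝 (T u))

/-- The positively homogeneous extension `F` of `f`: `F 0 = 0`, `F x = ‖x‖ • f (x/‖x‖)`. -/
def homExt {X E : Type*} [NormedAddCommGroup X] [NormedSpace ℝ X]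
    [NormedAddCommGroup E] [NormedSpace ℝ E] (f : X → E) (x : X) : E :=
  ‖x‖ • f (unitDir x)

/-- `F` is Gateaux differentiable at `y`: all one-sided directional derivatives exist and
depend linearly (and continuously) on the direction. -/
def GateauxAt {X E : Type*} [NormedAddCommGroup X] [NormedSpace ℝ X]
    [NormedAddCommGroup E] [NormedSpace ℝ E] (F : X → E) (y : X) : Prop :=
  ∃ L : X →L[ℝ] E, ∀ z : X,
    Tendsto (fun a : ℝ => a⁻¹ • (F (y + a • z) - F y)) (𝓝[>] 0) (𝓝 (L z))

/-- A bounded map into a proper space converges along every ultrafilter. -/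
lemma Ultrafilter.exists_tendsto_of_norm_le {ι V : Type*} [NormedAddCommGroup V] [ProperSpace V]
    (l : Ultrafilter ι) {F : ι → V} {C : ℝ} (h : ∀ᶠ t in (l : Filter ι), ‖F t‖ ≤ C) :
    ∃ a, Tendsto F l (𝓝 a) := by
  obtain ⟨a, -, ha⟩ := (isCompact_closedBall (0 : V) C).ultrafilter_le_nhds (l.map F) (by
    rw [le_principal_iff]
    exact h.mono fun t ht => mem_closedBall_zero_iff.2 ht)
  exact ⟨a, ha⟩

section suppFn

variable {V : Type*} [NormedAddCommGroup V] [NormedSpace ℝ V]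

lemma Filter.Tendsto.clm_apply_nhds {ι : Type*} {l : Filter ι} {k : ι → V →L[ℝ] ℝ} {p : ι → V}
    {h : V →L[ℝ] ℝ} {v : V} (hk : Tendsto k l (𝓝 h)) (hp : Tendsto p l (𝓝 v)) :
    Tendsto (fun t => k t (p t)) l (𝓝 (h v)) :=
  (isBoundedBilinearMap_apply.continuous.tendsto (h, v)).comp (hk.prodMk_nhds hp)

lemma apply_le_norm_of_norm_le_one {h : V →L[ℝ] ℝ} (hh : ‖h‖ ≤ 1) (v : V) : h v ≤ ‖v‖ :=
  (le_abs_self _).trans ((h.le_opNorm v).trans (mul_le_of_le_one_left (norm_nonneg v) hh))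

/-- Support functionals at points converging to `q` converge, along an ultrafilter, to a support
functional at `q`. -/
lemma exists_tendsto_suppFn [FiniteDimensional ℝ V] {ι : Type*} (l : Ultrafilter ι) {p : ι → V}
    {q : V} (hq : ‖q‖ = 1) (hp : Tendsto p l (𝓝 q)) :
    ∃ k : ι → V →L[ℝ] ℝ, ∃ h ∈ suppFn V q,
      (∀ t, ‖k t‖ ≤ 1 ∧ k t (p t) = ‖p t‖) ∧ Tendsto k l (𝓝 h) := by
  choose k hk using fun t => exists_dual_vector'' ℝ (p t)
  have : ProperSpace (V →L[ℝ] ℝ) := FiniteDimensional.proper ℝ _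
  obtain ⟨h, hh⟩ := l.exists_tendsto_of_norm_le (F := k) (Eventually.of_forall fun t => (hk t).1)
  have h1 : ‖h‖ ≤ 1 := le_of_tendsto hh.norm (Eventually.of_forall fun t => (hk t).1)
  have h2 : h q = 1 := by
    refine tendsto_nhds_unique (hh.clm_apply_nhds hp) ?_
    simpa [(hk _).2, hq] using hp.norm
  refine ⟨k, h, ⟨le_antisymm h1 ?_, h2⟩, hk, hh⟩
  simpa [h2, hq] using h.le_opNorm q

lemma apply_nonpos_of_tendsto {l : Filter ℝ} [l.NeBot] (hl : l ≤ 𝓝[>] 0) {p : ℝ → V} {q u : V}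
    (hp1 : ∀ᶠ t in l, ‖p t‖ = 1) (hu : Tendsto (fun t : ℝ => t⁻¹ • (p t - q)) l (𝓝 u))
    {h : V →L[ℝ] ℝ} (hh : h ∈ suppFn V q) : h u ≤ 0 := by
  refine le_of_tendsto ((h.continuous.tendsto u).comp hu) ?_
  filter_upwards [hp1, hl self_mem_nhdsWithin] with t ht ht0
  have := apply_le_norm_of_norm_le_one hh.1.le (p t)
  simp only [Function.comp, map_smul, map_sub, hh.2, smul_eq_mul]
  exact mul_nonpos_of_nonneg_of_nonpos (inv_nonneg.2 (le_of_lt ht0)) (by linarith)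

lemma tendsto_of_tendsto_inv_smul_sub {l : Filter ℝ} (hl : l ≤ 𝓝[>] 0) {p : ℝ → V} {q u : V}
    (hu : Tendsto (fun t : ℝ => t⁻¹ • (p t - q)) l (𝓝 u)) : Tendsto p l (𝓝 q) := by
  have ht : Tendsto (fun t : ℝ => t) l (𝓝 0) := hl.trans nhdsWithin_le_nhds
  have h := (ht.smul hu).add_const q
  rw [zero_smul, zero_add] at h
  refine h.congr' ?_
  filter_upwards [hl self_mem_nhdsWithin] with t ht0
  rw [smul_inv_smul₀ (ne_of_gt ht0), sub_add_cancel]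

/-- Tangent directions at a smooth point are annihilated by the support functional. -/
lemma apply_eq_zero_of_tendsto [FiniteDimensional ℝ V] {l : Ultrafilter ℝ}
    (hl : (l : Filter ℝ) ≤ 𝓝[>] 0) {p : ℝ → V} {q u : V} (hq : ‖q‖ = 1)
    (hp1 : ∀ᶠ t in (l : Filter ℝ), ‖p t‖ = 1)
    (hu : Tendsto (fun t : ℝ => t⁻¹ • (p t - q)) l (𝓝 u))
    {g : V →L[ℝ] ℝ} (hg : suppFn V q = {g}) : g u = 0 := by
  refine le_antisymm (apply_nonpos_of_tendsto hl hp1 hu (hg ▸ mem_singleton g)) ?_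
  obtain ⟨k, h, hh, hk, hkh⟩ :=
    exists_tendsto_suppFn l hq (tendsto_of_tendsto_inv_smul_sub hl hu)
  obtain rfl : h = g := by simpa [hg] using hh
  refine ge_of_tendsto (hkh.clm_apply_nhds hu) ?_
  filter_upwards [hp1, hl self_mem_nhdsWithin] with t ht ht0
  have := apply_le_norm_of_norm_le_one (hk t).1 q
  simp only [map_smul, map_sub, (hk t).2, smul_eq_mul, ht]
  exact mul_nonneg (inv_nonneg.2 (le_of_lt ht0)) (by linarith)

lemma tendsto_add_smul {l : Filter ℝ} (hl : l ≤ 𝓝[>] 0) (q w : V) :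
    Tendsto (fun t : ℝ => q + t • w) l (𝓝 q) := by
  have ht : Tendsto (fun t : ℝ => t) l (𝓝 0) := hl.trans nhdsWithin_le_nhds
  simpa using (ht.smul_const w).const_add q

lemma eventually_norm_add_smul_pos {l : Filter ℝ} (hl : l ≤ 𝓝[>] 0) {q : V} (hq : ‖q‖ = 1)
    (w : V) : ∀ᶠ t in l, 0 < ‖q + t • w‖ :=
  (tendsto_add_smul hl q w).norm.eventually_const_lt (by simp [hq])

lemma norm_unitDir {v : V} (hv : 0 < ‖v‖) : ‖unitDir v‖ = 1 := by
  rw [unitDir, norm_smul, norm_inv, norm_norm, inv_mul_cancel₀ hv.ne']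

lemma tendsto_inv_smul_unitDir_sub {l : Filter ℝ} (hl : l ≤ 𝓝[>] 0) {q w : V} (hq : ‖q‖ = 1)
    {c : ℝ} (hc : Tendsto (fun t : ℝ => t⁻¹ * (‖q + t • w‖ - 1)) l (𝓝 c)) :
    Tendsto (fun t : ℝ => t⁻¹ • (unitDir (q + t • w) - q)) l (𝓝 (w - c • q)) := by
  have h := ((tendsto_add_smul hl q w).norm.inv₀ (by simp [hq])).smul
    ((hc.smul_const q).const_sub w)
  rw [hq, inv_one, one_smul] at h
  refine h.congr' ?_
  filter_upwards [eventually_norm_add_smul_pos hl hq w, hl self_mem_nhdsWithin] with t ht ht0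
  have ht0 : t ≠ 0 := ne_of_gt ht0
  have ht := ht.ne'
  simp only [unitDir]
  match_scalars <;> field_simp
  ring

/-- At a smooth point the norm has vanishing right derivative in the directions annihilated by the
support functional. -/
lemma tendsto_inv_mul_norm_sub_one [FiniteDimensional ℝ V] {l : Ultrafilter ℝ}
    (hl : (l : Filter ℝ) ≤ 𝓝[>] 0) {q u : V} (hq : ‖q‖ = 1)
    {g : V →L[ℝ] ℝ} (hg : suppFn V q = {g}) (hu : g u = 0) :
    Tendsto (fun t : ℝ => t⁻¹ * (‖q + t • u‖ - 1)) l (𝓝 0) := by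
  obtain ⟨k, h, hh, hk, hkh⟩ := exists_tendsto_suppFn l hq (tendsto_add_smul hl q u)
  obtain rfl : h = g := by simpa [hg] using hh
  have hlim : Tendsto (fun t => k t u) l (𝓝 0) := hu ▸ hkh.clm_apply_nhds tendsto_const_nhds
  refine tendsto_of_tendsto_of_tendsto_of_le_of_le' tendsto_const_nhds hlim ?_ ?_
  · filter_upwards [hl self_mem_nhdsWithin] with t ht0
    have := apply_le_norm_of_norm_le_one hh.1.le (q + t • u)
    rw [map_add, map_smul, hu, hh.2, smul_zero, add_zero] at this
    exact mul_nonneg (inv_nonneg.2 (le_of_lt ht0)) (by linarith)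
  · filter_upwards [hl self_mem_nhdsWithin] with t ht0
    have ht0 : 0 < t := ht0
    have := apply_le_norm_of_norm_le_one (hk t).1 q
    rw [inv_mul_le_iff₀ ht0, ← (hk t).2, map_add, map_smul, smul_eq_mul]
    linarith

/-- A direction on which all support functionals at `q` are negative points from `q` to another
point of the unit sphere. -/
lemma exists_pos_norm_add_smul_eq_one [FiniteDimensional ℝ V] {q w : V} (hq : ‖q‖ = 1)
    (hw : ∀ h ∈ suppFn V q, h w < 0) : ∃ s > (0 : ℝ), ‖q + s • w‖ = 1 := by
  have hw0 : 0 < ‖w‖ := by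
    obtain ⟨g, hg1, hg2⟩ := exists_dual_vector ℝ q (by simp [hq])
    have := hw g ⟨hg1, by simpa [hq] using hg2⟩
    rw [norm_pos_iff]
    rintro rfl
    simp at this
  obtain ⟨t, ht0, ht⟩ : ∃ t > (0 : ℝ), ‖q + t • w‖ ≤ 1 := by
    by_contra! hcon
    let l : Ultrafilter ℝ := Ultrafilter.of (𝓝[>] 0)
    have hl : (l : Filter ℝ) ≤ 𝓝[>] 0 := Ultrafilter.of_le _
    obtain ⟨k, h, hh, hk, hkh⟩ := exists_tendsto_suppFn l hq (tendsto_add_smul hl q w)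
    refine (hw h hh).not_ge (ge_of_tendsto (hkh.clm_apply_nhds tendsto_const_nhds) ?_)
    filter_upwards [hl self_mem_nhdsWithin] with t ht0
    have ht0 : 0 < t := ht0
    have h1 := hcon t ht0
    have h2 := apply_le_norm_of_norm_le_one (hk t).1 q
    rw [← (hk t).2, map_add, map_smul, smul_eq_mul] at h1
    have : 0 < t * k t w := by linarith
    exact (pos_of_mul_pos_right this ht0.le).le
  have hT : 1 ≤ ‖q + (t + 2 / ‖w‖) • w‖ := by
    have h1 := norm_sub_norm_le ((t + 2 / ‖w‖) • w) (-q)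
    rw [sub_neg_eq_add, norm_neg, hq, norm_smul, Real.norm_of_nonneg (by positivity), add_mul,
      div_mul_cancel₀ _ hw0.ne', add_comm _ q] at h1
    have := mul_pos ht0 hw0
    linarith
  obtain ⟨s, hs, hs1⟩ := intermediate_value_Icc (f := fun s : ℝ => ‖q + s • w‖)
    (le_add_of_nonneg_right (by positivity : 0 ≤ 2 / ‖w‖)) (by fun_prop) ⟨ht, hT⟩
  exact ⟨s, ht0.trans_le hs.1, hs1⟩

lemma tendsto_inv_mul_norm_sub_sub_norm {l : Filter ℝ} (hl : l ≤ 𝓝[>] 0) {w v : V} {r : ℝ → V}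
    {L : V →L[ℝ] ℝ} (hL : HasFDerivAt (‖·‖) L w)
    (hr : Tendsto (fun t : ℝ => t⁻¹ • r t) l (𝓝 v)) :
    Tendsto (fun t : ℝ => t⁻¹ * (‖w - r t‖ - ‖w‖)) l (𝓝 (-L v)) := by
  have h0 : Tendsto r l (𝓝 0) := tendsto_of_tendsto_inv_smul_sub hl (by simpa using hr)
  have := (hasFDerivWithinAt_univ.2 hL).lim (c := fun t : ℝ => t⁻¹) (d := fun t => -r t)
    (by simpa using h0.neg) (Eventually.of_forall fun _ => mem_univ _)
    (by simpa only [smul_neg] using hr.neg)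
  simpa only [map_neg, ← sub_eq_add_neg, smul_eq_mul] using this

end suppFn

section Isometry

variable {X E : Type*} [NormedAddCommGroup X] [NormedSpace ℝ X]
  [NormedAddCommGroup E] [NormedSpace ℝ E] {f : X → E} {y : X}

/-- If the norm of `E` is differentiable at `f x - f y`, its derivative is nonpositive on sums of
images of opposite tangent directions at `y`. -/
lemma fderiv_add_nonpos
    (hiso : ∀ x ∈ sphere (0 : X) 1, ∀ x' ∈ sphere (0 : X) 1, ‖f x - f x'‖ = ‖x - x'‖)
    (hy : y ∈ sphere (0 : X) 1) {l : Filter ℝ} [l.NeBot] (hl : l ≤ 𝓝[>] 0)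
    {p p' : ℝ → X} {u : X} {v v' : E}
    (hp1 : ∀ᶠ t in l, ‖p t‖ = 1) (hp1' : ∀ᶠ t in l, ‖p' t‖ = 1)
    (hp : Tendsto (fun t : ℝ => t⁻¹ • (p t - y)) l (𝓝 u))
    (hp' : Tendsto (fun t : ℝ => t⁻¹ • (p' t - y)) l (𝓝 (-u)))
    (hv : Tendsto (fun t : ℝ => t⁻¹ • (f (p t) - f y)) l (𝓝 v))
    (hv' : Tendsto (fun t : ℝ => t⁻¹ • (f (p' t) - f y)) l (𝓝 v'))
    {x : X} (hx : x ∈ sphere (0 : X) 1) {L : E →L[ℝ] ℝ}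
    (hL : HasFDerivAt (‖·‖) L (f x - f y)) : L (v + v') ≤ 0 := by
  have h1 := (tendsto_inv_mul_norm_sub_sub_norm hl hL hv).add
    (tendsto_inv_mul_norm_sub_sub_norm hl hL hv')
  have h2 := (hp.add hp').norm.neg
  rw [add_neg_cancel, norm_zero, neg_zero] at h2
  have h3 : (0 : ℝ) ≤ -L v + -L v' := by
    refine le_of_tendsto_of_tendsto h2 h1 ?_
    filter_upwards [hp1, hp1', hl self_mem_nhdsWithin] with t ht ht' ht0
    have ht0 : 0 < t := ht0
    rw [sub_sub_sub_cancel_right, sub_sub_sub_cancel_right,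
      hiso x hx (p t) (by simpa using ht), hiso x hx (p' t) (by simpa using ht'),
      hiso x hx y hy,
      ← smul_add, norm_smul, norm_inv, Real.norm_of_nonneg ht0.le, ← mul_neg, ← mul_add]
    refine mul_le_mul_of_nonneg_left ?_ (inv_nonneg.2 ht0.le)
    have h4 : ‖(2 : ℝ) • (x - y)‖ = 2 * ‖x - y‖ := by rw [norm_smul]; norm_num
    have h5 : (2 : ℝ) • (x - y) = (x - p t) + (x - p' t) + ((p t - y) + (p' t - y)) := by module
    have h6 := norm_add₃_le (a := x - p t) (b := x - p' t) (c := (p t - y) + (p' t - y))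
    rw [← h5, h4] at h6
    linarith
  rw [map_add]
  linarith

/-- A surjective isometry of unit spheres sends opposite tangent directions to opposite tangent
directions. -/
lemma add_eq_zero_of_tendsto_of_tendsto_neg [FiniteDimensional ℝ E]
    (hbij : Set.BijOn f (sphere (0 : X) 1) (sphere (0 : E) 1))
    (hiso : ∀ x ∈ sphere (0 : X) 1, ∀ x' ∈ sphere (0 : X) 1, ‖f x - f x'‖ = ‖x - x'‖)
    (hy : y ∈ sphere (0 : X) 1) {l : Filter ℝ} [l.NeBot] (hl : l ≤ 𝓝[>] 0)
    {p p' : ℝ → X} {u : X} {v v' : E}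
    (hp1 : ∀ᶠ t in l, ‖p t‖ = 1) (hp1' : ∀ᶠ t in l, ‖p' t‖ = 1)
    (hp : Tendsto (fun t : ℝ => t⁻¹ • (p t - y)) l (𝓝 u))
    (hp' : Tendsto (fun t : ℝ => t⁻¹ • (p' t - y)) l (𝓝 (-u)))
    (hv : Tendsto (fun t : ℝ => t⁻¹ • (f (p t) - f y)) l (𝓝 v))
    (hv' : Tendsto (fun t : ℝ => t⁻¹ • (f (p' t) - f y)) l (𝓝 v')) : v + v' = 0 := by
  have hfy : ‖f y‖ = 1 := by simpa using hbij.mapsTo hy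
  have hfp : ∀ {p : ℝ → X}, (∀ᶠ t in l, ‖p t‖ = 1) → ∀ᶠ t in l, ‖f (p t)‖ = 1 := fun h =>
    h.mono fun t ht => by simpa using hbij.mapsTo (x := _) (by simpa using ht)
  have hd : ∀ h ∈ suppFn E (f y), h (v + v') ≤ 0 := fun h hh => by
    rw [map_add]
    exact add_nonpos (apply_nonpos_of_tendsto hl (hfp hp1) hv hh)
      (apply_nonpos_of_tendsto hl (hfp hp1') hv' hh)
  by_contra hne
  set d := v + v' with hd_def
  have hd0 : 0 < ‖d‖ := norm_pos_iff.2 hne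
  set ε := ‖d‖ / 4 with hε
  have hε0 : 0 < ε := by positivity
  obtain ⟨w, hw, hwd⟩ := Metric.dense_iff.1 dense_differentiableAt_norm (d - ε • f y) ε hε0
  rw [mem_ball_iff_norm] at hw
  obtain ⟨s, hs, hs1⟩ := exists_pos_norm_add_smul_eq_one (w := w) hfy fun h hh => by
    have h1 := apply_le_norm_of_norm_le_one hh.1.le (w - (d - ε • f y))
    have h2 := hd h hh
    simp only [map_sub, map_smul, hh.2, smul_eq_mul, mul_one] at h1
    linarith
  obtain ⟨x, hx, hxs⟩ := hbij.surjOn (show f y + s • w ∈ sphere (0 : E) 1 by simpa using hs1)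
  have hL := (DifferentiableAt.hasFDerivAt hwd).hasFDerivAt_norm_smul_pos hs
  rw [show s • w = f x - f y by rw [hxs, add_sub_cancel_left]] at hL
  have h1 := fderiv_add_nonpos hiso hy hl hp1 hp1' hp hp' hv hv' hx hL
  have h2 := apply_le_norm_of_norm_le_one (h := fderiv ℝ (‖·‖) w)
    (NNReal.coe_one ▸ norm_fderiv_le_of_lipschitz ℝ lipschitzWith_one_norm) (w - d)
  rw [map_sub, DifferentiableAt.fderiv_norm_self hwd] at h2
  have h3 : ‖w - d‖ ≤ ‖w - (d - ε • f y)‖ + ε := by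
    have := norm_sub_le (w - (d - ε • f y)) (ε • f y)
    rwa [norm_smul, hfy, mul_one, Real.norm_of_nonneg hε0.le,
      show w - (d - ε • f y) - ε • f y = w - d by abel] at this
  have h4 := norm_sub_norm_le d w
  rw [norm_sub_rev] at h4
  linarith

/-- All support functionals at the image of a smooth point agree at every vector. -/
lemma exists_forall_suppFn_apply_eq [FiniteDimensional ℝ X] [FiniteDimensional ℝ E]
    (hbij : Set.BijOn f (sphere (0 : X) 1) (sphere (0 : E) 1))
    (hiso : ∀ x ∈ sphere (0 : X) 1, ∀ x' ∈ sphere (0 : X) 1, ‖f x - f x'‖ = ‖x - x'‖)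
    (hy : y ∈ sphere (0 : X) 1) (hysm : IsSmoothPt y) (w : E) :
    ∃ c : ℝ, ∀ h ∈ suppFn E (f y), h w = c := by
  obtain ⟨g, hg⟩ := hysm
  have hfy : ‖f y‖ = 1 := by simpa using hbij.mapsTo hy
  have hy1 : ‖y‖ = 1 := by simpa using hy
  have : ProperSpace X := FiniteDimensional.proper ℝ X
  have : ProperSpace E := FiniteDimensional.proper ℝ E
  let l : Ultrafilter ℝ := Ultrafilter.of (𝓝[>] 0)
  have hl : (l : Filter ℝ) ≤ 𝓝[>] 0 := Ultrafilter.of_le _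
  have hpos : ∀ᶠ t in (l : Filter ℝ), 0 < t := hl self_mem_nhdsWithin
  obtain ⟨c, hc⟩ := l.exists_tendsto_of_norm_le (C := ‖w‖)
    (F := fun t : ℝ => t⁻¹ * (‖f y + t • w‖ - 1)) <| by
      filter_upwards [hpos] with t ht
      have := abs_norm_sub_norm_le (f y + t • w) (f y)
      rw [hfy, add_sub_cancel_left, norm_smul, Real.norm_of_nonneg ht.le] at this
      rwa [norm_mul, norm_inv, Real.norm_of_nonneg ht.le, inv_mul_le_iff₀ ht, Real.norm_eq_abs]
  have hv := tendsto_inv_smul_unitDir_sub hl hfy hc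
  set v := w - c • f y with hv_def
  have hz1 : ∀ᶠ t in (l : Filter ℝ), ‖unitDir (f y + t • w)‖ = 1 :=
    (eventually_norm_add_smul_pos hl hfy w).mono fun t => norm_unitDir
  obtain ⟨p, hp⟩ : ∃ p : ℝ → X, ∀ t, ‖unitDir (f y + t • w)‖ = 1 →
      ‖p t‖ = 1 ∧ f (p t) = unitDir (f y + t • w) := by
    refine ⟨fun t => Function.invFunOn f (sphere 0 1) (unitDir (f y + t • w)), fun t ht => ?_⟩
    have hmem := hbij.surjOn (mem_sphere_zero_iff_norm.2 ht)
    exact ⟨mem_sphere_zero_iff_norm.1 (Function.invFunOn_mem hmem), Function.invFunOn_eq hmem⟩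
  have hp1 : ∀ᶠ t in (l : Filter ℝ), ‖p t‖ = 1 := hz1.mono fun t ht => (hp t ht).1
  have hfv : Tendsto (fun t : ℝ => t⁻¹ • (f (p t) - f y)) l (𝓝 v) := by
    refine hv.congr' ?_
    filter_upwards [hz1] with t ht
    rw [(hp t ht).2]
  have hnorm : ∀ {p : ℝ → X} {t : ℝ}, ‖p t‖ = 1 →
      ‖t⁻¹ • (f (p t) - f y)‖ = ‖t⁻¹ • (p t - y)‖ := fun {p t} ht => by
    rw [norm_smul, norm_smul, hiso _ (by simpa using ht) y hy]
  obtain ⟨u, hu⟩ := l.exists_tendsto_of_norm_le (C := ‖v‖ + 1)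
    (F := fun t : ℝ => t⁻¹ • (p t - y)) <| by
      filter_upwards [hp1, hfv.norm.eventually_le_const (lt_add_one _)] with t ht ht'
      rwa [← hnorm ht]
  have hgu : g (-u) = 0 := by
    rw [map_neg, apply_eq_zero_of_tendsto hl hy1 hp1 hu hg, neg_zero]
  have hu' := tendsto_inv_smul_unitDir_sub hl hy1 (tendsto_inv_mul_norm_sub_one hl hy1 hg hgu)
  rw [zero_smul, sub_zero] at hu'
  have hp1' : ∀ᶠ t in (l : Filter ℝ), ‖unitDir (y + t • -u)‖ = 1 :=
    (eventually_norm_add_smul_pos hl hy1 (-u)).mono fun t => norm_unitDir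
  obtain ⟨v', hv'⟩ := l.exists_tendsto_of_norm_le (C := ‖-u‖ + 1)
    (F := fun t : ℝ => t⁻¹ • (f (unitDir (y + t • -u)) - f y)) <| by
      filter_upwards [hp1', hu'.norm.eventually_le_const (lt_add_one _)] with t ht ht'
      rwa [hnorm (p := fun t => unitDir (y + t • -u)) ht]
  have hsum := add_eq_zero_of_tendsto_of_tendsto_neg hbij hiso hy hl hp1 hp1' hu hu' hfv hv'
  refine ⟨c, fun h hh => ?_⟩
  have h1 := apply_nonpos_of_tendsto hl hz1 hv hh
  have h2 := apply_nonpos_of_tendsto hl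
    (hp1'.mono fun t ht => mem_sphere_zero_iff_norm.1
      (hbij.mapsTo (mem_sphere_zero_iff_norm.2 ht))) hv' hh
  rw [← neg_eq_of_add_eq_zero_right hsum, map_neg] at h2
  have h3 : h v = h w - c := by simp [hv_def, hh.2]
  linarith

end Isometry

/-- `f` maps smooth points of `S_X` to smooth points of `S_E`. -/
theorem maps_smooth_to_smooth {X E : Type*} [NormedAddCommGroup X] [NormedSpace ℝ X]
    [FiniteDimensional ℝ X] [NormedAddCommGroup E] [NormedSpace ℝ E] [FiniteDimensional ℝ E]
    (f : X → E) (hbij : Set.BijOn f (sphere (0 : X) 1) (sphere (0 : E) 1))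
    (hiso : ∀ x ∈ sphere (0 : X) 1, ∀ x' ∈ sphere (0 : X) 1, ‖f x - f x'‖ = ‖x - x'‖)
    (y : X) (hy : y ∈ sphere (0 : X) 1) (hysm : IsSmoothPt y) :
    IsSmoothPt (f y) := by
  have hfy : ‖f y‖ = 1 := by simpa using hbij.mapsTo hy
  obtain ⟨g, hg1, hg2⟩ := exists_dual_vector ℝ (f y) (by simp [hfy])
  have hg : g ∈ suppFn E (f y) := ⟨hg1, by simpa [hfy] using hg2⟩
  refine ⟨g, eq_singleton_iff_unique_mem.2 ⟨hg, fun h hh => ?_⟩⟩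
  ext w
  obtain ⟨c, hc⟩ := exists_forall_suppFn_apply_eq hbij hiso hy hysm w
  rw [hc h hh, hc g hg]
end
end

section
/- Let X and E be finite-dimensional real normed spaces, f : S_X → S_E a bijective isometry, and F its positively homogeneous extension. If y ∈ S_X satisfies span ℷ(y) = X*, then F is Gateaux differentiable at y. -/
open Filter Topology Metric Set MeasureTheory

noncomputable section

section SphereIsometry

variable {X E : Type*} [NormedAddCommGroup X] [NormedSpace ℝ X]
  [NormedAddCommGroup E] [NormedSpace ℝ E]

lemma norm_smul_unitDir (v : X) : ‖v‖ • unitDir v = v := by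
  rcases eq_or_ne v 0 with rfl | hv
  · simp
  · rw [unitDir, smul_inv_smul₀ (norm_ne_zero_iff.2 hv)]

lemma unitDir_mem_sphere {v : X} (hv : v ≠ 0) : unitDir v ∈ sphere (0 : X) 1 := by
  rw [mem_sphere_zero_iff_norm, unitDir, norm_smul, norm_inv, norm_norm,
    inv_mul_cancel₀ (norm_ne_zero_iff.2 hv)]

lemma unitDir_of_mem_sphere {v : X} (hv : v ∈ sphere (0 : X) 1) : unitDir v = v := by
  rw [unitDir, mem_sphere_zero_iff_norm.1 hv, inv_one, one_smul]

lemma homExt_of_mem_sphere (f : X → E) {v : X} (hv : v ∈ sphere (0 : X) 1) :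
    homExt f v = f v := by
  rw [homExt, unitDir_of_mem_sphere hv, mem_sphere_zero_iff_norm.1 hv, one_smul]

lemma norm_homExt {f : X → E} (hf : MapsTo f (sphere 0 1) (sphere 0 1)) (v : X) :
    ‖homExt f v‖ = ‖v‖ := by
  rcases eq_or_ne v 0 with rfl | hv
  · simp [homExt]
  · rw [homExt, norm_smul, mem_sphere_zero_iff_norm.1 (hf (unitDir_mem_sphere hv)), norm_norm,
      mul_one]

lemma norm_homExt_sub_smul {f : X → E}
    (hiso : ∀ x ∈ sphere (0 : X) 1, ∀ x' ∈ sphere (0 : X) 1, ‖f x - f x'‖ = ‖x - x'‖)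
    (v : X) {x : X} (hx : x ∈ sphere (0 : X) 1) :
    ‖homExt f v - ‖v‖ • f x‖ = ‖v - ‖v‖ • x‖ := by
  rcases eq_or_ne v 0 with rfl | hv
  · simp [homExt]
  · have h : v - ‖v‖ • x = ‖v‖ • (unitDir v - x) := by rw [smul_sub, norm_smul_unitDir]
    rw [h, homExt, ← smul_sub, norm_smul, norm_smul, hiso _ (unitDir_mem_sphere hv) _ hx]

lemma norm_homExt_sub_le {f : X → E} (hf : MapsTo f (sphere 0 1) (sphere 0 1))
    (hiso : ∀ x ∈ sphere (0 : X) 1, ∀ x' ∈ sphere (0 : X) 1, ‖f x - f x'‖ = ‖x - x'‖)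
    (v w : X) : ‖homExt f v - homExt f w‖ ≤ 3 * ‖v - w‖ := by
  rcases eq_or_ne w 0 with rfl | hw
  · have h0 : homExt f (0 : X) = 0 := by simp [homExt]
    rw [h0, sub_zero, sub_zero, norm_homExt hf]
    linarith [norm_nonneg v]
  have hx := unitDir_mem_sphere hw
  have h1 : homExt f v - homExt f w
      = (homExt f v - ‖v‖ • f (unitDir w)) + (‖v‖ - ‖w‖) • f (unitDir w) := by
    rw [homExt.eq_def f w]; module
  have h2 : v - ‖v‖ • unitDir w = (v - w) - (‖v‖ - ‖w‖) • unitDir w := by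
    rw [sub_smul, norm_smul_unitDir]; abel
  calc ‖homExt f v - homExt f w‖
      ≤ ‖v - ‖v‖ • unitDir w‖ + ‖(‖v‖ - ‖w‖) • f (unitDir w)‖ := by
        rw [h1, ← norm_homExt_sub_smul hiso v hx]; exact norm_add_le _ _
    _ ≤ ‖v - w‖ + ‖(‖v‖ - ‖w‖) • unitDir w‖ + ‖(‖v‖ - ‖w‖) • f (unitDir w)‖ := by
        rw [h2]; gcongr; exact norm_sub_le _ _
    _ ≤ 3 * ‖v - w‖ := by
        rw [norm_smul, norm_smul, mem_sphere_zero_iff_norm.1 hx,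
          mem_sphere_zero_iff_norm.1 (hf hx), Real.norm_eq_abs]
        linarith [abs_norm_sub_norm_le v w]

lemma norm_sub_le_homExt {f : X → E} (hf : MapsTo f (sphere 0 1) (sphere 0 1))
    (hiso : ∀ x ∈ sphere (0 : X) 1, ∀ x' ∈ sphere (0 : X) 1, ‖f x - f x'‖ = ‖x - x'‖)
    (v w : X) : ‖v - w‖ ≤ 3 * ‖homExt f v - homExt f w‖ := by
  rcases eq_or_ne w 0 with rfl | hw
  · have h0 : homExt f (0 : X) = 0 := by simp [homExt]
    rw [h0, sub_zero, sub_zero, norm_homExt hf]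
    linarith [norm_nonneg v]
  have hx := unitDir_mem_sphere hw
  have h1 : v - w = (v - ‖v‖ • unitDir w) + (‖v‖ - ‖w‖) • unitDir w := by
    rw [sub_smul, norm_smul_unitDir]; abel
  have h2 : homExt f v - ‖v‖ • f (unitDir w)
      = (homExt f v - homExt f w) - (‖v‖ - ‖w‖) • f (unitDir w) := by
    rw [homExt.eq_def f w]; module
  calc ‖v - w‖
      ≤ ‖homExt f v - ‖v‖ • f (unitDir w)‖ + ‖(‖v‖ - ‖w‖) • unitDir w‖ := by
        rw [norm_homExt_sub_smul hiso v hx]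
        nth_rw 1 [h1]
        exact norm_add_le _ _
    _ ≤ ‖homExt f v - homExt f w‖ + ‖(‖v‖ - ‖w‖) • f (unitDir w)‖
          + ‖(‖v‖ - ‖w‖) • unitDir w‖ := by
        rw [h2]; gcongr; exact norm_sub_le _ _
    _ ≤ 3 * ‖homExt f v - homExt f w‖ := by
        rw [norm_smul, norm_smul, mem_sphere_zero_iff_norm.1 hx,
          mem_sphere_zero_iff_norm.1 (hf hx), Real.norm_eq_abs]
        have := abs_norm_sub_norm_le (homExt f v) (homExt f w)
        rw [norm_homExt hf, norm_homExt hf] at this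
        linarith

lemma homExt_surjective {f : X → E} (hf : SurjOn f (sphere 0 1) (sphere 0 1)) :
    Function.Surjective (homExt f) := by
  intro e
  rcases eq_or_ne e 0 with rfl | he
  · exact ⟨0, by simp [homExt]⟩
  obtain ⟨x, hx, hfx⟩ := hf (unitDir_mem_sphere he)
  have he' : (0 : ℝ) < ‖e‖ := norm_pos_iff.2 he
  refine ⟨‖e‖ • x, ?_⟩
  have hn : ‖‖e‖ • x‖ = ‖e‖ := by
    rw [norm_smul, norm_norm, mem_sphere_zero_iff_norm.1 hx, mul_one]
  rw [homExt, unitDir, hn, inv_smul_smul₀ he'.ne', hfx, norm_smul_unitDir]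

lemma finrank_eq_of_sphere_isometry [FiniteDimensional ℝ X] [FiniteDimensional ℝ E] {f : X → E}
    (hbij : BijOn f (sphere (0 : X) 1) (sphere (0 : E) 1))
    (hiso : ∀ x ∈ sphere (0 : X) 1, ∀ x' ∈ sphere (0 : X) 1, ‖f x - f x'‖ = ‖x - x'‖) :
    Module.finrank ℝ X = Module.finrank ℝ E := by
  have hl : LipschitzWith 3 (homExt f) := LipschitzWith.of_dist_le_mul fun v w => by
    simpa [dist_eq_norm] using norm_homExt_sub_le hbij.mapsTo hiso v w
  have ha : AntilipschitzWith 3 (homExt f) := AntilipschitzWith.of_le_mul_dist fun v w => by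
    simpa [dist_eq_norm] using norm_sub_le_homExt hbij.mapsTo hiso v w
  have h1 := hl.dimH_image_le univ
  have h2 := ha.le_dimH_image univ
  rw [image_univ_of_surjective (homExt_surjective hbij.surjOn), Real.dimH_univ_eq_finrank,
    Real.dimH_univ_eq_finrank] at h1 h2
  exact le_antisymm (by exact_mod_cast h2) (by exact_mod_cast h1)

lemma apply_le_norm_of_norm_le_one_s14 {g : X →L[ℝ] ℝ} (hg : ‖g‖ ≤ 1) (v : X) : g v ≤ ‖v‖ :=
  (le_abs_self _).trans (by simpa using g.le_of_opNorm_le hg v)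

lemma map_neg_of_span_suppFn {f : X → E}
    (hbij : BijOn f (sphere (0 : X) 1) (sphere (0 : E) 1))
    (hiso : ∀ x ∈ sphere (0 : X) 1, ∀ x' ∈ sphere (0 : X) 1, ‖f x - f x'‖ = ‖x - x'‖)
    {y : X} (hy : y ∈ sphere (0 : X) 1) (hspan : Submodule.span ℝ (suppFn X y) = ⊤) :
    f (-y) = -f y := by
  have key : ∀ x ∈ sphere (0 : X) 1, ∃ p ∈ sphere (0 : X) 1, f p = -f x := fun x hx =>
    hbij.surjOn (by simpa using hbij.mapsTo hx)
  have hy1 := mem_sphere_zero_iff_norm.1 hy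
  obtain ⟨p, hp, hfp⟩ := key y hy
  have hp1 := mem_sphere_zero_iff_norm.1 hp
  have hk : ∀ k ∈ suppFn X y, k (p + y) = 0 := by
    rintro k ⟨hk1, hky⟩
    apply le_antisymm
    · have bound : ∀ s : ℝ, 0 < s → s * ‖p + y‖ < 1 → k (p + y) ≤ s * (4 * ‖p + y‖) := by
        intro s hs hs1
        set u := p + y with hu
        set v := y + s • u with hv
        have hvy : ‖v - y‖ = s * ‖u‖ := by
          rw [hv, add_sub_cancel_left, norm_smul, Real.norm_of_nonneg hs.le]
        have hN := abs_norm_sub_norm_le v y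
        rw [hy1, hvy] at hN
        have hv0 : v ≠ 0 := by
          rintro h
          rw [h, norm_zero, zero_sub, abs_neg, abs_one] at hN
          linarith
        have hx := unitDir_mem_sphere hv0
        set x := unitDir v with hxd
        have hx1 := mem_sphere_zero_iff_norm.1 hx
        obtain ⟨q, hq, hfq⟩ := key x hx
        have hxv : ‖v - x‖ ≤ s * ‖u‖ := by
          have : v - x = (‖v‖ - 1) • x := by
            rw [sub_smul, one_smul, hxd, norm_smul_unitDir]
          rw [this, norm_smul, hx1, mul_one]
          exact hN
        have hxy : ‖x - y‖ ≤ 2 * (s * ‖u‖) := by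
          have : x - y = (v - y) - (v - x) := by abel
          rw [this]
          linarith [norm_sub_le (v - y) (v - x)]
        have hqp : ‖q - p‖ = ‖x - y‖ := by
          rw [← hiso q hq p hp, hfq, hfp, ← hiso x hx y hy, ← norm_neg]
          congr 1; abel
        have hxq : ‖x - q‖ = 2 := by
          rw [← hiso x hx q hq, hfq, sub_neg_eq_add, ← two_smul ℝ, norm_smul,
            mem_sphere_zero_iff_norm.1 (hbij.mapsTo hx)]
          norm_num
        obtain ⟨g, hg1, hg⟩ := exists_dual_vector'' ℝ (x - q)
        have hgx := apply_le_norm_of_norm_le_one_s14 hg1 x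
        have hgq := apply_le_norm_of_norm_le_one_s14 hg1 (-q)
        have hgy := apply_le_norm_of_norm_le_one_s14 hg1 y
        rw [norm_neg, mem_sphere_zero_iff_norm.1 hq] at hgq
        simp only [hxq, RCLike.ofReal_real_eq_id, id, map_sub, map_neg] at hg hgq
        rw [hx1] at hgx
        rw [hy1] at hgy
        have hgv : g v = ‖v‖ := by
          rw [← norm_smul_unitDir v, map_smul, ← hxd, smul_eq_mul, norm_smul, hx1, norm_norm]
          rw [show g x = 1 by linarith]
        have hgu : g u ≤ 4 * (s * ‖u‖) := by
          have e : u = (x + q) - (x - y) - (q - p) := by rw [hu]; abel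
          have h3 := apply_le_norm_of_norm_le_one_s14 hg1 (-(x - y))
          have h4 := apply_le_norm_of_norm_le_one_s14 hg1 (-(q - p))
          rw [norm_neg, map_neg] at h3 h4
          have h5 : g u = g x + g q - g (x - y) - g (q - p) := by
            rw [e, map_sub, map_sub, map_add]
          linarith
        have hkv := apply_le_norm_of_norm_le_one_s14 hk1.le v
        rw [← hgv, hv, map_add, map_add, hky, map_smul, map_smul, smul_eq_mul, smul_eq_mul] at hkv
        have : s * k u ≤ s * (s * (4 * ‖u‖)) := by nlinarith
        exact le_of_mul_le_mul_left this hs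
      have ht : Tendsto (fun s : ℝ => s * (4 * ‖p + y‖)) (𝓝[>] 0) (𝓝 0) := by
        have : Tendsto (fun s : ℝ => s * (4 * ‖p + y‖)) (𝓝 0) (𝓝 (0 * (4 * ‖p + y‖))) :=
          (continuous_id.mul continuous_const).tendsto 0
        rw [zero_mul] at this
        exact this.mono_left nhdsWithin_le_nhds
      have hs1 : ∀ᶠ s : ℝ in 𝓝[>] 0, s * ‖p + y‖ < 1 := by
        have : Tendsto (fun s : ℝ => s * ‖p + y‖) (𝓝 0) (𝓝 (0 * ‖p + y‖)) :=
          (continuous_id.mul continuous_const).tendsto 0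
        rw [zero_mul] at this
        exact (this.mono_left nhdsWithin_le_nhds).eventually_lt_const one_pos
      refine ge_of_tendsto ht ?_
      filter_upwards [hs1, self_mem_nhdsWithin] with s h1 h0 using bound s h0 h1
    · have := apply_le_norm_of_norm_le_one_s14 hk1.le (-p)
      rw [norm_neg, hp1, map_neg] at this
      rw [map_add, hky]
      linarith
  have hpy : p + y = 0 := by
    obtain ⟨g, -, hg⟩ := exists_dual_vector'' ℝ (p + y)
    have : Submodule.span ℝ (suppFn X y) ≤
        LinearMap.ker (ContinuousLinearMap.apply ℝ ℝ (p + y)).toLinearMap :=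
      Submodule.span_le.2 fun k hkm => hk k hkm
    have h0 : g (p + y) = 0 := this (hspan ▸ Submodule.mem_top : g ∈ _)
    rw [h0] at hg
    exact norm_eq_zero.1 (by simpa using hg.symm)
  rw [← eq_neg_of_add_eq_zero_left hpy, hfp]

/-- The positively homogeneous map with value `y - x` at each point `x` of the unit sphere. -/
def reflCone (y w : X) : X := ‖w‖ • y - w

lemma reflCone_eq_smul_sub (y w : X) : reflCone y w = ‖w‖ • (y - unitDir w) := by
  rw [smul_sub, norm_smul_unitDir, reflCone]

lemma reflCone_homExt {f : X → E} (hf : MapsTo f (sphere 0 1) (sphere 0 1)) (e : E) (w : X) :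
    reflCone e (homExt f w) = ‖w‖ • (e - f (unitDir w)) := by
  rw [reflCone, norm_homExt hf, homExt, smul_sub]

lemma norm_reflCone_sub_le {y : X} (hy : ‖y‖ = 1) (w w' : X) :
    ‖reflCone y w - reflCone y w'‖ ≤ 2 * ‖w - w'‖ := by
  have e : reflCone y w - reflCone y w' = (‖w‖ - ‖w'‖) • y - (w - w') := by
    rw [reflCone, reflCone]; module
  rw [e]
  have := norm_sub_le ((‖w‖ - ‖w'‖) • y) (w - w')
  rw [norm_smul, hy, mul_one, Real.norm_eq_abs] at this
  linarith [abs_norm_sub_norm_le w w']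

lemma norm_sub_le_reflCone {y : X} (hy : ‖y‖ = 1) {w w' : X} (hw : ‖w + y‖ < 1 / 2)
    (hw' : ‖w' + y‖ < 1 / 2) : ‖w - w'‖ ≤ 2 * ‖reflCone y w - reflCone y w'‖ := by
  wlog h : ‖w'‖ ≤ ‖w‖ generalizing w w'
  · rw [norm_sub_rev, norm_sub_rev (reflCone y w)]
    exact this hw' hw (not_le.1 h).le
  set r := reflCone y w - reflCone y w' with hr
  set δ := ‖w‖ - ‖w'‖ with hδ
  have hδ0 : 0 ≤ δ := sub_nonneg.2 h
  have hwr : w - w' = δ • y - r := by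
    rw [hr, hδ, reflCone, reflCone]; module
  have hww : ‖w - w'‖ ≤ ‖w + y‖ + ‖w' + y‖ := by
    have : w - w' = (w + y) - (w' + y) := by abel
    rw [this]; exact norm_sub_le _ _
  have hδ1 : δ ≤ 1 := by linarith [norm_sub_norm_le w w']
  have hw2 : 1 / 2 ≤ ‖w'‖ := by
    have := norm_sub_norm_le y (-w')
    rw [norm_neg, hy, sub_neg_eq_add, add_comm] at this
    linarith
  have hconv : w = (1 - δ) • w' + δ • (w' + y) - r := by
    have : w = w' + (w - w') := by abel
    rw [this, hwr]; module
  have hnw : ‖w‖ ≤ (1 - δ) * ‖w'‖ + δ * ‖w' + y‖ + ‖r‖ := by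
    calc ‖w‖ = ‖(1 - δ) • w' + δ • (w' + y) - r‖ := by rw [← hconv]
      _ ≤ ‖(1 - δ) • w'‖ + ‖δ • (w' + y)‖ + ‖r‖ :=
          (norm_sub_le _ _).trans (by gcongr; exact norm_add_le _ _)
      _ = _ := by
          rw [norm_smul, norm_smul, Real.norm_of_nonneg hδ0, Real.norm_of_nonneg (sub_nonneg.2 hδ1)]
  have hδr : δ ≤ ‖r‖ := by nlinarith
  have := norm_sub_le (δ • y) r
  rw [norm_smul, hy, mul_one, Real.norm_of_nonneg hδ0, ← hwr] at this
  linarith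

lemma hausdorffMeasure_inter_preimage_eq_zero {Y Z : Type*}
    [NormedAddCommGroup Y] [MeasurableSpace Y] [BorelSpace Y]
    [NormedAddCommGroup Z] [MeasurableSpace Z] [BorelSpace Z] {Φ : Y → Z} {B : Set Y}
    {K : NNReal} {d : ℝ} (hd : 0 ≤ d)
    (hΦ : ∀ w ∈ B, ∀ w' ∈ B, ‖w - w'‖ ≤ K * ‖Φ w - Φ w'‖) {N : Set Z}
    (hN : Measure.hausdorffMeasure d N = 0) :
    Measure.hausdorffMeasure d (B ∩ Φ ⁻¹' N) = 0 := by
  have ha : AntilipschitzWith K (B.domRestrict Φ) := AntilipschitzWith.of_le_mul_dist fun v w => by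
    rw [Subtype.dist_eq, dist_eq_norm, dist_eq_norm]
    exact hΦ v v.2 w w.2
  have h1 := ha.hausdorffMeasure_preimage_le hd N
  rw [hN, mul_zero, nonpos_iff_eq_zero] at h1
  rw [← Subtype.image_preimage_coe,
    isometry_subtype_coe.hausdorffMeasure_image (Or.inl hd)]
  exact h1

lemma exists_differentiableAt_norm_reflCone [FiniteDimensional ℝ X] [FiniteDimensional ℝ E]
    {f : X → E} (hbij : BijOn f (sphere (0 : X) 1) (sphere (0 : E) 1))
    (hiso : ∀ x ∈ sphere (0 : X) 1, ∀ x' ∈ sphere (0 : X) 1, ‖f x - f x'‖ = ‖x - x'‖)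
    {y : X} (hy : y ∈ sphere (0 : X) 1) (hneg : f (-y) = -f y) {w₀ : X}
    (hw₀ : ‖w₀ + y‖ < 1 / 6) {ε : ℝ} (hε : 0 < ε) :
    ∃ w : X, ‖w - w₀‖ < ε ∧ ‖w + y‖ < 1 / 6 ∧
      DifferentiableAt ℝ (fun v : X => ‖v‖) (reflCone y w) ∧
      DifferentiableAt ℝ (fun v : E => ‖v‖) (reflCone (f y) (homExt f w)) := by
  let _ : MeasurableSpace X := borel X
  have _ : BorelSpace X := ⟨rfl⟩
  let _ : MeasurableSpace E := borel E
  have _ : BorelSpace E := ⟨rfl⟩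
  have hy1 := mem_sphere_zero_iff_norm.1 hy
  have hfy1 := mem_sphere_zero_iff_norm.1 (hbij.mapsTo hy)
  have hmaps : ∀ w ∈ ball (-y) (1 / 6), ‖w + y‖ < 1 / 6 ∧ ‖homExt f w + f y‖ < 1 / 2 := by
    intro w hw
    rw [mem_ball_iff_norm, sub_neg_eq_add] at hw
    refine ⟨hw, ?_⟩
    have h := norm_homExt_sub_le hbij.mapsTo hiso w (-y)
    rw [homExt_of_mem_sphere f (by simpa using hy : -y ∈ sphere (0 : X) 1), hneg, sub_neg_eq_add,
      sub_neg_eq_add] at h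
    linarith
  have hX : Measure.hausdorffMeasure (Module.finrank ℝ X)
      {v : X | ¬ DifferentiableAt ℝ (fun v : X => ‖v‖) v} = 0 :=
    ae_differentiableAt_norm (μ := (Measure.hausdorffMeasure (Module.finrank ℝ X) : Measure X))
  have hE : Measure.hausdorffMeasure (Module.finrank ℝ X)
      {v : E | ¬ DifferentiableAt ℝ (fun v : E => ‖v‖) v} = 0 := by
    rw [finrank_eq_of_sphere_isometry hbij hiso]
    exact ae_differentiableAt_norm
      (μ := (Measure.hausdorffMeasure (Module.finrank ℝ E) : Measure E))
  have h1 := hausdorffMeasure_inter_preimage_eq_zero (K := 2) (Φ := reflCone y)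
    (B := ball (-y) (1 / 6)) (Nat.cast_nonneg _)
    (fun w hw w' hw' => by
      simpa using norm_sub_le_reflCone hy1 ((hmaps w hw).1.trans (by norm_num))
        ((hmaps w' hw').1.trans (by norm_num))) hX
  have h2 := hausdorffMeasure_inter_preimage_eq_zero (K := 6)
    (Φ := fun w => reflCone (f y) (homExt f w)) (B := ball (-y) (1 / 6)) (Nat.cast_nonneg _)
    (fun w hw w' hw' => by
      have a1 := norm_sub_le_reflCone hfy1 (hmaps w hw).2 (hmaps w' hw').2
      have a2 := norm_sub_le_homExt hbij.mapsTo hiso w w'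
      push_cast
      linarith) hE
  have hae : ∀ᵐ w ∂(Measure.hausdorffMeasure (Module.finrank ℝ X) : Measure X),
      w ∈ ball (-y) (1 / 6) → DifferentiableAt ℝ (fun v : X => ‖v‖) (reflCone y w) ∧
      DifferentiableAt ℝ (fun v : E => ‖v‖) (reflCone (f y) (homExt f w)) := by
    filter_upwards [measure_eq_zero_iff_ae_notMem.1 h1, measure_eq_zero_iff_ae_notMem.1 h2]
      with w hw1 hw2 hw
    exact ⟨by_contra fun h => hw1 ⟨hw, h⟩, by_contra fun h => hw2 ⟨hw, h⟩⟩
  obtain ⟨w, hw, hwb, hwε⟩ := (Measure.dense_of_ae hae).exists_mem_open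
    ((isOpen_ball (x := -y) (ε := 1 / 6)).inter (isOpen_ball (x := w₀) (ε := ε)))
    ⟨w₀, by rwa [mem_ball_iff_norm, sub_neg_eq_add], mem_ball_self hε⟩
  exact ⟨w, mem_ball_iff_norm.1 hwε, (hmaps w hwb).1, hw hwb⟩

/-- The difference quotient at `y` in the direction `d` of the homogeneous extension of `f`. -/
def diffQuot (f : X → E) (y d : X) (a : ℝ) : E := a⁻¹ • (homExt f (y + a • d) - homExt f y)

lemma norm_diffQuot_le {f : X → E} (hf : MapsTo f (sphere 0 1) (sphere 0 1))
    (hiso : ∀ x ∈ sphere (0 : X) 1, ∀ x' ∈ sphere (0 : X) 1, ‖f x - f x'‖ = ‖x - x'‖)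
    (y d : X) {a : ℝ} (ha : 0 < a) : ‖diffQuot f y d a‖ ≤ 3 * ‖d‖ := by
  have h := norm_homExt_sub_le hf hiso (y + a • d) y
  rw [add_sub_cancel_left, norm_smul, Real.norm_of_nonneg ha.le] at h
  rw [diffQuot, norm_smul, norm_inv, Real.norm_of_nonneg ha.le, inv_mul_le_iff₀ ha]
  linarith

lemma HasFDerivAt.eventually_abs_norm_add_sub_le {p : X} {g : X →L[ℝ] ℝ}
    (hg : HasFDerivAt (fun v : X => ‖v‖) g p) {A : ℝ → X} {C c : ℝ} (hc : 0 < c)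
    (hA : ∀ a : ℝ, 0 < a → ‖A a‖ ≤ a * C) :
    ∀ᶠ a in 𝓝[>] (0 : ℝ), |‖p + A a‖ - ‖p‖ - g (A a)| ≤ c * (a * C) := by
  have hlim : Tendsto (fun a => p + A a) (𝓝[>] 0) (𝓝 p) := by
    have h0 : Tendsto A (𝓝[>] 0) (𝓝 0) := by
      have h1 : Tendsto (fun a : ℝ => a * C) (𝓝[>] 0) (𝓝 0) := by
        have : Tendsto (fun a : ℝ => a * C) (𝓝 0) (𝓝 (0 * C)) :=
          (continuous_id.mul continuous_const).tendsto 0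
        rw [zero_mul] at this
        exact this.mono_left nhdsWithin_le_nhds
      exact squeeze_zero_norm' (eventually_mem_nhdsWithin.mono fun a ha => hA a ha) h1
    simpa using h0.const_add p
  filter_upwards [hlim.eventually (hg.isLittleO.def hc), self_mem_nhdsWithin] with a h ha
  rw [add_sub_cancel_left, Real.norm_eq_abs] at h
  exact h.trans (by gcongr; exact hA a ha)

lemma eventually_abs_diffQuot_sub_le {f : X → E}
    (hf : MapsTo f (sphere 0 1) (sphere 0 1))
    (hiso : ∀ x ∈ sphere (0 : X) 1, ∀ x' ∈ sphere (0 : X) 1, ‖f x - f x'‖ = ‖x - x'‖)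
    {x y : X} (hx : x ∈ sphere (0 : X) 1) (hy : y ∈ sphere (0 : X) 1)
    {g : X →L[ℝ] ℝ} {g' : E →L[ℝ] ℝ} (hg : HasFDerivAt (fun v : X => ‖v‖) g (y - x))
    (hg' : HasFDerivAt (fun v : E => ‖v‖) g' (f y - f x)) (d : X) {η : ℝ} (hη : 0 < η) :
    ∀ᶠ a in 𝓝[>] (0 : ℝ), |g' (diffQuot f y d a) - g d| ≤ ‖d‖ * |g x - g' (f x)| + η := by
  have hy1 := mem_sphere_zero_iff_norm.1 hy
  have hx1 := mem_sphere_zero_iff_norm.1 hx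
  have hfx1 := mem_sphere_zero_iff_norm.1 (hf hx)
  set N : ℝ → ℝ := fun a => ‖y + a • d‖ with hN
  have hNa : ∀ a : ℝ, 0 < a → |N a - 1| ≤ a * ‖d‖ := by
    intro a ha
    have h := abs_norm_sub_norm_le (y + a • d) y
    rwa [add_sub_cancel_left, hy1, norm_smul, Real.norm_of_nonneg ha.le] at h
  set A : ℝ → X := fun a => a • d - (N a - 1) • x with hA
  set B : ℝ → E := fun a => a • diffQuot f y d a - (N a - 1) • f x with hB
  have hAn : ∀ a : ℝ, 0 < a → ‖A a‖ ≤ a * (4 * ‖d‖) := by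
    intro a ha
    have h := norm_sub_le (a • d) ((N a - 1) • x)
    rw [norm_smul, norm_smul, hx1, mul_one, Real.norm_of_nonneg ha.le, Real.norm_eq_abs] at h
    have := mul_nonneg ha.le (norm_nonneg d)
    linarith [hNa a ha]
  have hBn : ∀ a : ℝ, 0 < a → ‖B a‖ ≤ a * (4 * ‖d‖) := by
    intro a ha
    have h := norm_sub_le (a • diffQuot f y d a) ((N a - 1) • f x)
    rw [norm_smul, norm_smul, hfx1, mul_one, Real.norm_of_nonneg ha.le, Real.norm_eq_abs] at h
    have := mul_le_mul_of_nonneg_left (norm_diffQuot_le hf hiso y d ha) ha.le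
    linarith [hNa a ha]
  have hc : 0 < η / (8 * ‖d‖ + 1) := by positivity
  filter_upwards [hg.eventually_abs_norm_add_sub_le hc hAn,
    hg'.eventually_abs_norm_add_sub_le hc hBn, self_mem_nhdsWithin] with a h1 h2 ha
  have ha : 0 < a := ha
  have eA : y - x + A a = (y + a • d) - N a • x := by rw [hA]; module
  have eB : f y - f x + B a = homExt f (y + a • d) - N a • f x := by
    simp only [hB, diffQuot, smul_inv_smul₀ ha.ne', homExt_of_mem_sphere f hy]
    module
  rw [eA] at h1
  rw [eB, norm_homExt_sub_smul hiso _ hx, hiso y hy x hx] at h2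
  have h3 : |g' (B a) - g (A a)| ≤ a * η := by
    have h4 : |g' (B a) - g (A a)| ≤ 2 * (η / (8 * ‖d‖ + 1) * (a * (4 * ‖d‖))) := by
      rw [abs_le] at h1 h2 ⊢
      constructor <;> linarith
    refine h4.trans ?_
    have h5 : 8 * ‖d‖ * (η / (8 * ‖d‖ + 1)) ≤ η := by
      rw [mul_div_assoc', div_le_iff₀ (by positivity)]
      linarith
    have := mul_le_mul_of_nonneg_left h5 ha.le
    linarith
  have h6 : a * (g' (diffQuot f y d a) - g d)
      = (g' (B a) - g (A a)) - (N a - 1) * (g x - g' (f x)) := by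
    simp only [hA, hB, map_sub, map_smul, smul_eq_mul]
    ring
  refine le_of_mul_le_mul_left ?_ ha
  calc a * |g' (diffQuot f y d a) - g d|
      = |(g' (B a) - g (A a)) - (N a - 1) * (g x - g' (f x))| := by
        rw [← h6, abs_mul, abs_of_pos ha]
    _ ≤ a * η + a * ‖d‖ * |g x - g' (f x)| := by
        refine (abs_sub _ _).trans ?_
        rw [abs_mul]
        gcongr
        exact hNa a ha
    _ = a * (‖d‖ * |g x - g' (f x)| + η) := by ring

lemma norm_le_one_of_hasFDerivAt_norm {p : X} {g : X →L[ℝ] ℝ}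
    (hg : HasFDerivAt (fun v : X => ‖v‖) g p) : ‖g‖ ≤ 1 := by
  simpa using hg.le_of_lipschitz lipschitzWith_one_norm

lemma apply_self_of_hasFDerivAt_norm {p : X} {g : X →L[ℝ] ℝ}
    (hg : HasFDerivAt (fun v : X => ‖v‖) g p) : g p = ‖p‖ := by
  rw [← hg.fderiv]
  exact hg.differentiableAt.fderiv_norm_self

lemma abs_apply_sub_apply_le {f : X → E} (hf : MapsTo f (sphere 0 1) (sphere 0 1))
    (hiso : ∀ x ∈ sphere (0 : X) 1, ∀ x' ∈ sphere (0 : X) 1, ‖f x - f x'‖ = ‖x - x'‖)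
    {x y : X} (hx : x ∈ sphere (0 : X) 1) (hy : y ∈ sphere (0 : X) 1)
    {g : X →L[ℝ] ℝ} {g' : E →L[ℝ] ℝ} (hg : HasFDerivAt (fun v : X => ‖v‖) g (y - x))
    (hg' : HasFDerivAt (fun v : E => ‖v‖) g' (f y - f x)) :
    |g x - g' (f x)| ≤ ‖x + y‖ := by
  have hg1 := norm_le_one_of_hasFDerivAt_norm hg
  have hg1' := norm_le_one_of_hasFDerivAt_norm hg'
  have e := apply_self_of_hasFDerivAt_norm hg
  have e' := apply_self_of_hasFDerivAt_norm hg'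
  rw [hiso y hy x hx] at e'
  rw [map_sub] at e e'
  have a1 := apply_le_norm_of_norm_le_one_s14 hg1 y
  have a2 := apply_le_norm_of_norm_le_one_s14 hg1' (f y)
  have a3 := apply_le_norm_of_norm_le_one_s14 hg1 (-x)
  have a4 := apply_le_norm_of_norm_le_one_s14 hg1' (-f x)
  rw [norm_neg, map_neg] at a3 a4
  rw [mem_sphere_zero_iff_norm.1 hy] at a1
  rw [mem_sphere_zero_iff_norm.1 hx] at a3
  rw [mem_sphere_zero_iff_norm.1 (hf hy)] at a2
  rw [mem_sphere_zero_iff_norm.1 (hf hx)] at a4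
  have hd : 2 - ‖x + y‖ ≤ ‖y - x‖ := by
    have h := norm_sub_norm_le ((2 : ℝ) • y) (x + y)
    rw [norm_smul, mem_sphere_zero_iff_norm.1 hy, Real.norm_two, mul_one] at h
    rwa [show (2 : ℝ) • y - (x + y) = y - x by module] at h
  rw [abs_le]
  constructor <;> linarith

lemma exists_approx_derivPair [FiniteDimensional ℝ X] [FiniteDimensional ℝ E]
    {f : X → E} (hbij : BijOn f (sphere (0 : X) 1) (sphere (0 : E) 1))
    (hiso : ∀ x ∈ sphere (0 : X) 1, ∀ x' ∈ sphere (0 : X) 1, ‖f x - f x'‖ = ‖x - x'‖)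
    {y : X} (hy : y ∈ sphere (0 : X) 1) (hneg : f (-y) = -f y)
    {k : X →L[ℝ] ℝ} (hk : k ∈ suppFn X y) (u : X) {ε : ℝ} (hε : 0 < ε) :
    ∃ (g : X →L[ℝ] ℝ) (g' : E →L[ℝ] ℝ), ‖g‖ ≤ 1 ∧ ‖g'‖ ≤ 1 ∧ k u ≤ g u + ε ∧
      ∀ d : X, ∀ᶠ a in 𝓝[>] (0 : ℝ), |g' (diffQuot f y d a) - g d| ≤ (‖d‖ + 1) * ε := by
  have hy1 := mem_sphere_zero_iff_norm.1 hy
  obtain ⟨s, hs, hsu, hsε⟩ : ∃ s : ℝ, 0 < s ∧ s * ‖u‖ + s * s < 1 / 6 ∧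
      2 * (s * ‖u‖ + s * s) + 4 * s ≤ ε := by
    have h1 : Tendsto (fun s : ℝ => s * ‖u‖ + s * s) (𝓝[>] 0) (𝓝 0) := by
      have : Continuous fun s : ℝ => s * ‖u‖ + s * s := by fun_prop
      simpa using (this.tendsto 0).mono_left nhdsWithin_le_nhds
    have h2 : Tendsto (fun s : ℝ => 2 * (s * ‖u‖ + s * s) + 4 * s) (𝓝[>] 0) (𝓝 0) := by
      have : Continuous fun s : ℝ => 2 * (s * ‖u‖ + s * s) + 4 * s := by fun_prop
      simpa using (this.tendsto 0).mono_left nhdsWithin_le_nhds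
    obtain ⟨s, ⟨a1, a2⟩, a3⟩ := ((h1.eventually_lt_const (by norm_num : (0 : ℝ) < 1 / 6)).and
      (h2.eventually_lt_const hε)).and self_mem_nhdsWithin |>.exists
    exact ⟨s, a3, a1, a2.le⟩
  set w₀ : X := -(y + s • u) with hw₀
  have hw₀y : ‖w₀ + y‖ = s * ‖u‖ := by
    rw [show w₀ + y = -(s • u) by rw [hw₀]; abel, norm_neg, norm_smul, Real.norm_of_nonneg hs.le]
  have hss : 0 < s * s := mul_pos hs hs
  obtain ⟨w, hww, hwy, hdX, hdE⟩ := exists_differentiableAt_norm_reflCone hbij hiso hy hneg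
    (by rw [hw₀y]; linarith : ‖w₀ + y‖ < 1 / 6) hss
  have hw0 : w ≠ 0 := by
    rintro rfl
    rw [zero_add, hy1] at hwy
    norm_num at hwy
  have hwn : 0 < ‖w‖ := norm_pos_iff.2 hw0
  have hx := unitDir_mem_sphere hw0
  have eX := reflCone_eq_smul_sub y w
  rw [reflCone_homExt hbij.mapsTo] at hdE
  have hgX := hdX.hasFDerivAt
  have hgE := (hdE.differentiableAt_norm_of_smul).hasFDerivAt
  have hdX' := hdX
  rw [eX] at hdX'
  have hgX' := (hdX'.differentiableAt_norm_of_smul).hasFDerivAt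
  rw [← fderiv_norm_smul_pos hwn, ← eX] at hgX'
  set g := fderiv ℝ (fun v : X => ‖v‖) (reflCone y w)
  set g' := fderiv ℝ (fun v : E => ‖v‖) (f y - f (unitDir w))
  have hg1 := norm_le_one_of_hasFDerivAt_norm hgX
  have hxy : ‖unitDir w + y‖ ≤ 2 * (s * ‖u‖ + s * s) := by
    have h1 : ‖w + y‖ ≤ s * ‖u‖ + s * s := by
      have := norm_add_le (w - w₀) (w₀ + y)
      rw [← add_assoc, sub_add_cancel, hw₀y] at this
      linarith
    have h2 : ‖unitDir w - w‖ ≤ ‖w + y‖ := by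
      have e : unitDir w - w = (1 - ‖w‖) • unitDir w := by
        rw [sub_smul, one_smul, norm_smul_unitDir]
      rw [e, norm_smul, mem_sphere_zero_iff_norm.1 hx, mul_one, Real.norm_eq_abs]
      have := abs_norm_sub_norm_le y (-w)
      rwa [hy1, norm_neg, sub_neg_eq_add, add_comm y] at this
    have := norm_add_le (unitDir w - w) (w + y)
    rw [← add_assoc, sub_add_cancel] at this
    linarith
  refine ⟨g, g', hg1, norm_le_one_of_hasFDerivAt_norm hgE, ?_, fun d => ?_⟩
  · set q := reflCone y w₀ with hq
    have hqe : q = (‖w₀‖ + 1) • y + s • u := by rw [hq, reflCone, hw₀]; module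
    have hdist : ‖q - reflCone y w‖ ≤ 2 * (s * s) := by
      have := norm_reflCone_sub_le hy1 w₀ w
      rw [norm_sub_rev w₀] at this
      linarith
    have hkq := apply_le_norm_of_norm_le_one_s14 hk.1.le q
    have hgy := apply_le_norm_of_norm_le_one_s14 hg1 y
    have hgq := apply_le_norm_of_norm_le_one_s14 hg1 (-(q - reflCone y w))
    have hgs := apply_self_of_hasFDerivAt_norm hgX
    have htri := norm_sub_norm_le q (reflCone y w)
    rw [norm_neg, map_neg, map_sub, hgs] at hgq
    rw [hy1] at hgy
    have e1 : k q = ‖w₀‖ + 1 + s * k u := by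
      rw [hqe, map_add, map_smul, map_smul, hk.2, smul_eq_mul, smul_eq_mul, mul_one]
    have e2 : g q = (‖w₀‖ + 1) * g y + s * g u := by
      rw [hqe, map_add, map_smul, map_smul, smul_eq_mul, smul_eq_mul]
    have h1 : (‖w₀‖ + 1) * g y ≤ ‖w₀‖ + 1 := mul_le_of_le_one_right (by positivity) hgy
    have h2 : s * k u ≤ s * (g u + 4 * s) := by linarith
    have := le_of_mul_le_mul_left h2 hs
    have h3 : 0 ≤ s * ‖u‖ := by positivity
    linarith
  · filter_upwards [eventually_abs_diffQuot_sub_le hbij.mapsTo hiso hx hy hgX' hgE d hε] with a ha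
    have h1 := abs_apply_sub_apply_le hbij.mapsTo hiso hx hy hgX' hgE
    have h2 := mul_le_mul_of_nonneg_left (h1.trans (hxy.trans (by linarith) : _ ≤ ε))
      (norm_nonneg d)
    linarith

/-- The pairs `(g, h)` of functionals such that `h` of the difference quotients of the
homogeneous extension of `f` at `y` converges to `g` in every direction. -/
def derivPairs (f : X → E) (y : X) : Submodule ℝ ((X →L[ℝ] ℝ) × (E →L[ℝ] ℝ)) where
  carrier := {p | ∀ d, Tendsto (fun a => p.2 (diffQuot f y d a)) (𝓝[>] 0) (𝓝 (p.1 d))}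
  add_mem' hp hq d := (hp d).add (hq d)
  zero_mem' _ := tendsto_const_nhds
  smul_mem' c _ hp d := (hp d).const_mul c

lemma exists_mem_derivPairs [FiniteDimensional ℝ X] [FiniteDimensional ℝ E]
    {f : X → E} (hbij : BijOn f (sphere (0 : X) 1) (sphere (0 : E) 1))
    (hiso : ∀ x ∈ sphere (0 : X) 1, ∀ x' ∈ sphere (0 : X) 1, ‖f x - f x'‖ = ‖x - x'‖)
    {y : X} (hy : y ∈ sphere (0 : X) 1) (hneg : f (-y) = -f y)
    {k : X →L[ℝ] ℝ} (hk : k ∈ suppFn X y) (u : X) :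
    ∃ p ∈ derivPairs f y, k u ≤ p.1 u := by
  have hpos : ∀ n : ℕ, (0 : ℝ) < 1 / ((n : ℝ) + 1) := fun n => by positivity
  choose g g' hg hg' hku hd using
    fun n : ℕ => exists_approx_derivPair hbij hiso hy hneg hk u (hpos n)
  have : ProperSpace (X →L[ℝ] ℝ) := FiniteDimensional.proper_real _
  have : ProperSpace (E →L[ℝ] ℝ) := FiniteDimensional.proper_real _
  obtain ⟨⟨h, h'⟩, -, φ, hφ, hlim⟩ := ((isCompact_closedBall (0 : X →L[ℝ] ℝ) 1).prod
    (isCompact_closedBall (0 : E →L[ℝ] ℝ) 1)).tendsto_subseq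
    (x := fun n => (g n, g' n)) (fun n => by simpa using ⟨hg n, hg' n⟩)
  have l1 : Tendsto (fun n => g (φ n)) atTop (𝓝 h) := (continuous_fst.tendsto _).comp hlim
  have l2 : Tendsto (fun n => g' (φ n)) atTop (𝓝 h') := (continuous_snd.tendsto _).comp hlim
  have l0 : Tendsto (fun n => 1 / ((φ n : ℝ) + 1)) atTop (𝓝 0) :=
    tendsto_one_div_add_atTop_nhds_zero_nat.comp hφ.tendsto_atTop
  have ev : ∀ d : X, Tendsto (fun n => g (φ n) d) atTop (𝓝 (h d)) := fun d =>
    ((ContinuousLinearMap.apply ℝ ℝ d).continuous.tendsto h).comp l1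
  refine ⟨(h, h'), fun d => ?_, ?_⟩
  · rw [Metric.tendsto_nhds]
    intro ε hε
    have c1 : Tendsto (fun n => ‖h' - g' (φ n)‖ * (3 * ‖d‖) + (‖d‖ + 1) * (1 / ((φ n : ℝ) + 1))
        + |g (φ n) d - h d|) atTop (𝓝 0) := by
      have b1 := ((tendsto_const_nhds (x := h')).sub l2).norm.mul_const (3 * ‖d‖)
      have b2 := l0.const_mul (‖d‖ + 1)
      have b3 := ((ev d).sub_const (h d)).abs
      simpa using (b1.add b2).add b3
    obtain ⟨n, hn⟩ := (c1.eventually_lt_const hε).exists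
    filter_upwards [hd (φ n) d, self_mem_nhdsWithin] with a ha ha0
    have b4 : |(h' - g' (φ n)) (diffQuot f y d a)| ≤ ‖h' - g' (φ n)‖ * (3 * ‖d‖) :=
      ((h' - g' (φ n)).le_opNorm _).trans
        (mul_le_mul_of_nonneg_left (norm_diffQuot_le hbij.mapsTo hiso y d ha0) (norm_nonneg _))
    rw [sub_apply] at b4
    rw [Real.dist_eq]
    have b5 := abs_add_three (h' (diffQuot f y d a) - g' (φ n) (diffQuot f y d a))
      (g' (φ n) (diffQuot f y d a) - g (φ n) d) (g (φ n) d - h d)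
    rw [show h' (diffQuot f y d a) - g' (φ n) (diffQuot f y d a)
      + (g' (φ n) (diffQuot f y d a) - g (φ n) d) + (g (φ n) d - h d)
      = h' (diffQuot f y d a) - h d by ring] at b5
    linarith
  · have := (ev u).add l0
    rw [add_zero] at this
    exact ge_of_tendsto' this fun n => hku (φ n)

lemma exists_eval_eq_of_strongDual [FiniteDimensional ℝ X] (φ : (X →L[ℝ] ℝ) →ₗ[ℝ] ℝ) :
    ∃ u : X, ∀ g : X →L[ℝ] ℝ, φ g = g u := by
  let b := Module.finBasis ℝ X
  refine ⟨∑ i, φ (b.coord i).toContinuousLinearMap • b i, fun g => ?_⟩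
  have hg : g = ∑ i, g (b i) • (b.coord i).toContinuousLinearMap := by
    ext v
    conv_lhs => rw [← b.sum_repr v, map_sum]
    simp [mul_comm]
  conv_lhs => rw [hg]
  simp [mul_comm]

lemma finrank_strongDual [FiniteDimensional ℝ X] :
    Module.finrank ℝ (X →L[ℝ] ℝ) = Module.finrank ℝ X := by
  rw [← (LinearMap.toContinuousLinearMap (𝕜 := ℝ) (E := X) (F' := ℝ)).finrank_eq]
  exact Subspace.dual_finrank_eq

lemma map_fst_derivPairs [FiniteDimensional ℝ X] [FiniteDimensional ℝ E]
    {f : X → E} (hbij : BijOn f (sphere (0 : X) 1) (sphere (0 : E) 1))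
    (hiso : ∀ x ∈ sphere (0 : X) 1, ∀ x' ∈ sphere (0 : X) 1, ‖f x - f x'‖ = ‖x - x'‖)
    {y : X} (hy : y ∈ sphere (0 : X) 1) (hspan : Submodule.span ℝ (suppFn X y) = ⊤) :
    (derivPairs f y).map (LinearMap.fst ℝ _ _) = ⊤ := by
  by_contra hne
  obtain ⟨φ, hφ, hle⟩ := Submodule.exists_le_ker_of_lt_top _ (lt_top_iff_ne_top.2 hne)
  obtain ⟨u, hu⟩ := exists_eval_eq_of_strongDual φ
  have hp : ∀ p ∈ derivPairs f y, p.1 u = 0 := fun p hp => by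
    rw [← hu]; exact hle ⟨p, hp, rfl⟩
  have hneg := map_neg_of_span_suppFn hbij hiso hy hspan
  have hker : Submodule.span ℝ (suppFn X y) ≤ LinearMap.ker φ := by
    refine Submodule.span_le.2 fun k hk => ?_
    obtain ⟨p, hpm, h1⟩ := exists_mem_derivPairs hbij hiso hy hneg hk u
    obtain ⟨q, hqm, h2⟩ := exists_mem_derivPairs hbij hiso hy hneg hk (-u)
    rw [hp p hpm] at h1
    rw [map_neg, map_neg, hp q hqm] at h2
    rw [SetLike.mem_coe, LinearMap.mem_ker, hu]
    linarith
  rw [hspan, top_le_iff, LinearMap.ker_eq_top] at hker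
  exact hφ hker

lemma map_snd_derivPairs [FiniteDimensional ℝ X] [FiniteDimensional ℝ E]
    {f : X → E} (hbij : BijOn f (sphere (0 : X) 1) (sphere (0 : E) 1))
    (hiso : ∀ x ∈ sphere (0 : X) 1, ∀ x' ∈ sphere (0 : X) 1, ‖f x - f x'‖ = ‖x - x'‖)
    {y : X} (hy : y ∈ sphere (0 : X) 1) (hspan : Submodule.span ℝ (suppFn X y) = ⊤) :
    (derivPairs f y).map (LinearMap.snd ℝ _ _) = ⊤ := by
  have hinj : Function.Injective ((LinearMap.snd ℝ (X →L[ℝ] ℝ) (E →L[ℝ] ℝ)).domRestrict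
      (derivPairs f y)) := by
    refine (injective_iff_map_eq_zero _).2 ?_
    rintro ⟨⟨g, g'⟩, hp⟩ h0
    obtain rfl : g' = 0 := h0
    obtain rfl : g = 0 := by
      ext d
      exact tendsto_nhds_unique (hp d) tendsto_const_nhds
    rfl
  have h1 := LinearMap.finrank_range_of_inj hinj
  rw [LinearMap.range_domRestrict] at h1
  have h2 := Submodule.finrank_map_le (LinearMap.fst ℝ (X →L[ℝ] ℝ) (E →L[ℝ] ℝ)) (derivPairs f y)
  rw [map_fst_derivPairs hbij hiso hy hspan, finrank_top] at h2
  apply Submodule.eq_top_of_finrank_eq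
  apply le_antisymm (Submodule.finrank_le _)
  rw [finrank_strongDual, ← finrank_eq_of_sphere_isometry hbij hiso, ← finrank_strongDual, h1]
  exact h2

end SphereIsometry

/-- **Theorem (differentiability, case 2).** If `span ℷ(y) = X*`, then the homogeneous
extension `F` of `f` is Gateaux differentiable at `y`. -/
theorem gateaux_at_full_support {X E : Type*} [NormedAddCommGroup X] [NormedSpace ℝ X]
    [FiniteDimensional ℝ X] [NormedAddCommGroup E] [NormedSpace ℝ E] [FiniteDimensional ℝ E]
    (f : X → E) (hbij : Set.BijOn f (sphere (0 : X) 1) (sphere (0 : E) 1))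
    (hiso : ∀ x ∈ sphere (0 : X) 1, ∀ x' ∈ sphere (0 : X) 1, ‖f x - f x'‖ = ‖x - x'‖)
    (y : X) (hy : y ∈ sphere (0 : X) 1)
    (hspan : Submodule.span ℝ (suppFn X y) = ⊤) :
    GateauxAt (homExt f) y := by
  let b := Module.finBasis ℝ E
  have hcoord : ∀ i, ∃ g : X →L[ℝ] ℝ, ∀ d, Tendsto
      (fun a => b.coord i (diffQuot f y d a)) (𝓝[>] 0) (𝓝 (g d)) := fun i => by
    have h : (b.coord i).toContinuousLinearMap ∈
        (derivPairs f y).map (LinearMap.snd ℝ (X →L[ℝ] ℝ) (E →L[ℝ] ℝ)) := by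
      rw [map_snd_derivPairs hbij hiso hy hspan]; trivial
    obtain ⟨p, hp, hpi⟩ := h
    refine ⟨p.1, fun d => ?_⟩
    have := hp d
    rw [show p.2 = _ from hpi] at this
    exact this
  choose g hg using hcoord
  refine ⟨∑ i, (g i).smulRight (b i), fun d => ?_⟩
  have h := tendsto_finsetSum Finset.univ fun i _ => (hg i d).smul_const (b i)
  simp only [Module.Basis.coord_apply, b.sum_repr] at h
  simpa [diffQuot] using h
end
end
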